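/- arXiv:1909.09949 — 2 statements merged into one kernel-verified Lean document; each statement's English description precedes it below -/
import Mathlib

section
/- For all n, k ≥ 0, the number of permutations π of {1, …, n+k} satisfying −k ≤ π(i) − i ≤ n for all i equals ∑_{m=0}^{min(n,k)} m! · S(n+1, m+1) · m! · S(k+1, m+1). -/
open Finset

attribute [local instance] Classical.propDecidable

/-- A Vesztergombi permutation: a permutation `π` of `{1, …, n+k}` (modelled on `Fin (n+k)`)
with `-k ≤ π(i) - i ≤ n` for all `i`. -/
def IsVesztergombi (n k : ℕ) (π : Equiv.Perm (Fin (n + k))) : Prop :=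
  ∀ i, -(k : ℤ) ≤ (π i : ℤ) - (i : ℤ) ∧ (π i : ℤ) - (i : ℤ) ≤ (n : ℤ)

/-- The Stirling numbers of the second kind. -/
def stirling : ℕ → ℕ → ℕ
  | 0, 0 => 1
  | 0, _ + 1 => 0
  | _ + 1, 0 => 0
  | n + 1, k + 1 => stirling n k + (k + 1) * stirling n (k + 1)

/-- A partial injection given as an option-valued function, below the staircase. -/
def StairPI {k N : ℕ} (f : Fin k → Option (Fin N)) : Prop :=
  (∀ a a' d, f a = some d → f a' = some d → a = a') ∧
    ∀ a d, f a = some d → d.val ≤ a.val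

/-- Number of undefined entries. -/
noncomputable def nones {A D : Type*} [Fintype A] (f : A → Option D) : ℕ :=
  (univ.filter (fun a => f a = none)).card

theorem stair_snoc {k N : ℕ} (f : Fin k → Option (Fin N)) (x : Option (Fin N)) :
    StairPI (Fin.snoc f x : Fin (k+1) → Option (Fin N)) ↔
      StairPI f ∧ (∀ d, x = some d → d.val ≤ k ∧ ∀ a, f a ≠ some d) := by
  constructor
  · rintro ⟨h1, h2⟩
    refine ⟨⟨?_, ?_⟩, ?_⟩
    · intro a a' d h h'
      have := h1 a.castSucc a'.castSucc d (by simpa using h) (by simpa using h')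
      simpa using this
    · intro a d h
      simpa using h2 a.castSucc d (by simpa using h)
    · intro d hd
      refine ⟨by simpa using h2 (Fin.last k) d (by simpa using hd), ?_⟩
      intro a ha
      have := h1 a.castSucc (Fin.last k) d (by simpa using ha) (by simpa using hd)
      exact absurd this (Fin.castSucc_lt_last a).ne
  · rintro ⟨⟨h1, h2⟩, h3⟩
    refine ⟨?_, ?_⟩
    · intro a a' d
      refine Fin.lastCases ?_ (fun a => ?_) a <;> refine Fin.lastCases ?_ (fun a' => ?_) a' <;>
        simp only [Fin.snoc_last, Fin.snoc_castSucc] <;> intro h h'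
      · trivial
      · exact absurd h' ((h3 d h).2 a')
      · exact absurd h ((h3 d h').2 a)
      · rw [h1 a a' d h h']
    · intro a d
      refine Fin.lastCases ?_ (fun a => ?_) a <;> 
        simp only [Fin.snoc_last, Fin.snoc_castSucc] <;> intro h
      · simpa using (h3 d h).1
      · simpa using h2 a d h

theorem nones_snoc {k N : ℕ} (f : Fin k → Option (Fin N)) (x : Option (Fin N)) :
    nones (Fin.snoc f x : Fin (k+1) → Option (Fin N)) = nones f + if x = none then 1 else 0 := by
  unfold nones
  simp only [Finset.card_filter, Fin.sum_univ_castSucc, Fin.snoc_last, Fin.snoc_castSucc]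

/-- The number of values used plus the number of undefined entries. -/
theorem card_used {A D : Type*} [Fintype A] [Fintype D] (f : A → Option D)
    (hf : ∀ a a' d, f a = some d → f a' = some d → a = a') :
    (univ.filter (fun d => ∃ a, f a = some d)).card + nones f = Fintype.card A := by
  have h : (univ.filter (fun d => ∃ a, f a = some d)).card
      = (univ.filter (fun a => ¬ f a = none)).card := by
    symm
    refine Finset.card_bij (fun a ha => (f a).get (by
      simpa [Option.isSome_iff_ne_none] using ha)) ?_ ?_ ?_
    · intro a ha
      simp only [mem_filter, mem_univ, true_and]
      exact ⟨a, by simp⟩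
    · intro a ha a' ha' h
      exact hf a a' _ (Option.some_get _).symm (by rw [h]; exact (Option.some_get _).symm)
    · intro d hd
      simp only [mem_filter, mem_univ, true_and] at hd
      obtain ⟨a, ha⟩ := hd
      exact ⟨a, by simp [ha], by simp [ha]⟩
  rw [h, nones, add_comm, Finset.card_filter_add_card_filter_not, Finset.card_univ]

theorem card_avail {k N : ℕ} (hk : k < N) (f : Fin k → Option (Fin N)) (hf : StairPI f) :
    (univ.filter (fun d : Fin N => d.val ≤ k ∧ ∀ a, f a ≠ some d)).card = nones f + 1 := by
  have h1 : (univ.filter (fun d => ∃ a, f a = some d)).card + nones f = k := by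
    have h := card_used f hf.1
    rw [Fintype.card_fin] at h
    convert h
  have h2 : (univ.filter (fun d : Fin N => d.val ≤ k)).card = k + 1 := by
    have : (univ.filter (fun d : Fin N => d.val ≤ k)) = Finset.Iic ⟨k, hk⟩ := by
      ext d; simp [Fin.le_def]
    rw [this]; simp
  have h3 : (univ.filter (fun d : Fin N => d.val ≤ k))
      = (univ.filter (fun d : Fin N => d.val ≤ k ∧ ∀ a, f a ≠ some d)) ∪
        (univ.filter (fun d => ∃ a, f a = some d)) := by
    ext d
    simp only [mem_filter, mem_univ, true_and, mem_union]
    constructor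
    · intro h
      by_cases h' : ∃ a, f a = some d
      · exact Or.inr h'
      · push Not at h'; exact Or.inl ⟨h, h'⟩
    · rintro (h | ⟨a, ha⟩)
      · exact h.1
      · have := hf.2 a d ha
        omega
  rw [h3, Finset.card_union_of_disjoint] at h2
  · omega
  · rw [Finset.disjoint_filter]
    rintro d - ⟨-, h⟩ ⟨a, ha⟩
    exact h a ha

theorem card_stair (N k m : ℕ) (hk : k ≤ N) :
    (univ.filter (fun f : Fin k → Option (Fin N) => StairPI f ∧ nones f = m)).card
      = stirling (k + 1) (m + 1) := by
  induction k generalizing m with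
  | zero =>
    have : ∀ f : Fin 0 → Option (Fin N), (StairPI f ∧ nones f = m) ↔ m = 0 := by
      intro f
      have : StairPI f := ⟨fun a => a.elim0, fun a => a.elim0⟩
      simp [this, nones, eq_comm]
    simp only [this]
    cases m <;> simp [stirling]
  | succ k ih =>
    rw [Finset.card_filter,
      ← (Fin.snocEquiv (fun _ : Fin (k+1) => Option (Fin N))).sum_comp, Fintype.sum_prod_type_right]
    have key : ∀ f : Fin k → Option (Fin N),
        (∑ x : Option (Fin N), if StairPI (Fin.snoc f x : Fin (k+1) → Option (Fin N)) ∧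
          nones (Fin.snoc f x : Fin (k+1) → Option (Fin N)) = m then 1 else 0)
        = (if StairPI f ∧ nones f + 1 = m then 1 else 0) +
          (m + 1) * (if StairPI f ∧ nones f = m then 1 else 0) := by
      intro f
      rw [Fintype.sum_option]
      simp only [stair_snoc, nones_snoc]
      congr 1
      · simp
      · by_cases hf : StairPI f
        · by_cases hm : nones f = m
          · simp only [hf, hm, true_and, Option.some.injEq, forall_eq']
            rw [← Finset.card_filter]
            simp [card_avail (by omega) f hf, hm]
          · simp [hm]
        · simp [hf]
    refine (Finset.sum_congr rfl fun f _ => key f).trans ?_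
    rw [Finset.sum_add_distrib, ← Finset.mul_sum, ← Finset.card_filter, ← Finset.card_filter,
      ih m (by omega)]
    cases m with
    | zero => simp [stirling]
    | succ m =>
      simp only [Nat.add_right_cancel_iff]
      rw [ih m (by omega), stirling.eq_4 (k+1) (m+1)]

theorem stirling_zero_of_lt : ∀ n m : ℕ, n < m → stirling n m = 0
  | _, 0, h => absurd h (Nat.not_lt_zero _)
  | 0, _ + 1, _ => by rw [stirling]
  | n + 1, m + 1, h => by
    rw [stirling, stirling_zero_of_lt n m (by omega), stirling_zero_of_lt n (m+1) (by omega), mul_zero, add_zero]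

/-- The two partial maps of a bijection. -/
def partF {A B C D : Type*} (e : A ⊕ B ≃ C ⊕ D) : A → Option D := fun a => (e (Sum.inl a)).getRight?
def partG {A B C D : Type*} (e : A ⊕ B ≃ C ⊕ D) : B → Option C := fun b => (e (Sum.inr b)).getLeft?

theorem card_avail' {A D : Type*} [Fintype A] [Fintype D] (h : Fintype.card A = Fintype.card D)
    (f : A → Option D) (hf : ∀ a a' d, f a = some d → f a' = some d → a = a') :
    Fintype.card {d // ∀ a, f a ≠ some d} = nones f := by
  have h1 := card_used f hf
  rw [Fintype.card_subtype]
  have h2 := Finset.card_filter_add_card_filter_not (s := (univ : Finset D))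
    (fun d => ∃ a, f a = some d)
  push Not at h2
  rw [Finset.card_univ] at h2
  omega

/-- Gluing. -/
noncomputable def glue {A B C D : Type*} (f : A → Option D) (g : B → Option C)
    (p : ({a // f a = none} ↪ {c // ∀ b, g b ≠ some c}) ×
      ({b // g b = none} ↪ {d // ∀ a, f a ≠ some d})) : A ⊕ B → C ⊕ D
  | Sum.inl a => if h : f a = none then Sum.inl (p.1 ⟨a, h⟩).1 else
      Sum.inr ((f a).get (Option.isSome_iff_ne_none.2 h))
  | Sum.inr b => if h : g b = none then Sum.inr (p.2 ⟨b, h⟩).1 else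
      Sum.inl ((g b).get (Option.isSome_iff_ne_none.2 h))

theorem glue_inj {A B C D : Type*} (f : A → Option D) (g : B → Option C)
    (hf : ∀ a a' d, f a = some d → f a' = some d → a = a')
    (hg : ∀ a a' d, g a = some d → g a' = some d → a = a') (p) :
    Function.Injective (glue f g p) := by
  have F : ∀ a (h : (f a).isSome) b (h' : g b = none), (f a).get h ≠ (p.2 ⟨b, h'⟩).1 := by
    intro a h b h' e
    exact (p.2 ⟨b, h'⟩).2 a (by rw [← e]; simp)
  have G : ∀ b (h : (g b).isSome) a (h' : f a = none), (g b).get h ≠ (p.1 ⟨a, h'⟩).1 := by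
    intro a h b h' e
    exact (p.1 ⟨b, h'⟩).2 a (by rw [← e]; simp)
  rintro (x | x) (y | y) h <;> unfold glue at h <;> simp only at h <;> split_ifs at h with h1 h2 h2
  · have := p.1.injective (Subtype.ext (Sum.inl.inj h)); simp_all
  · have := Sum.inr.inj h
    rw [hf x y _ (Option.some_get _).symm (by rw [this]; exact (Option.some_get _).symm)]
  · exact absurd (Sum.inl.inj h).symm (G _ _ _ _)
  · exact absurd (Sum.inr.inj h) (F _ _ _ _)
  · exact absurd (Sum.inr.inj h).symm (F _ _ _ _)
  · exact absurd (Sum.inl.inj h) (G _ _ _ _)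
  · have := p.2.injective (Subtype.ext (Sum.inr.inj h)); simp_all
  · have := Sum.inl.inj h
    rw [hg x y _ (Option.some_get _).symm (by rw [this]; exact (Option.some_get _).symm)]

theorem card_fiber {A B C D : Type*} [Fintype A] [Fintype B] [Fintype C] [Fintype D]
    (hAD : Fintype.card A = Fintype.card D) (hBC : Fintype.card B = Fintype.card C)
    (f : A → Option D) (g : B → Option C)
    (hf : ∀ a a' d, f a = some d → f a' = some d → a = a')
    (hg : ∀ a a' d, g a = some d → g a' = some d → a = a') :
    (univ.filter (fun e : A ⊕ B ≃ C ⊕ D => partF e = f ∧ partG e = g)).card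
      = if nones f = nones g then (nones f).factorial * (nones f).factorial else 0 := by
  have hcard : Fintype.card (A ⊕ B) = Fintype.card (C ⊕ D) := by
    simp [hAD, hBC, add_comm]
  have h1 : Fintype.card (({a // f a = none} ↪ {c // ∀ b, g b ≠ some c}) ×
      ({b // g b = none} ↪ {d // ∀ a, f a ≠ some d})) =
      if nones f = nones g then (nones f).factorial * (nones f).factorial else 0 := by
    rw [Fintype.card_prod, Fintype.card_embedding_eq, Fintype.card_embedding_eq,
      card_avail' hAD f hf, card_avail' hBC g hg, Fintype.card_subtype, Fintype.card_subtype]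
    change (nones g).descFactorial (nones f) * (nones f).descFactorial (nones g) = _
    split_ifs with h
    · rw [h, Nat.descFactorial_self]
    · rcases lt_or_gt_of_ne h with h | h
      · rw [Nat.descFactorial_of_lt h, mul_zero]
      · rw [Nat.descFactorial_of_lt h, zero_mul]
  rw [← h1, ← Finset.card_univ]
  symm
  refine Finset.card_bij (fun p _ => Equiv.ofBijective (glue f g p)
    ((Fintype.bijective_iff_injective_and_card _).2 ⟨glue_inj f g hf hg p, hcard⟩)) ?_ ?_ ?_
  · intro p _
    simp only [mem_filter, mem_univ, true_and]
    constructor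
    · funext a
      simp only [partF, Equiv.ofBijective_apply, glue]
      split_ifs with h <;> simp [h]
    · funext a
      simp only [partG, Equiv.ofBijective_apply, glue]
      split_ifs with h <;> simp [h]
  · intro p _ q _ h
    have h' : ∀ x, glue f g p x = glue f g q x := fun x => by
      simpa using congrArg (fun e : A ⊕ B ≃ C ⊕ D => e x) h
    apply Prod.ext
    · ext ⟨a, ha⟩
      simpa [glue, ha] using h' (Sum.inl a)
    · ext ⟨a, ha⟩
      simpa [glue, ha] using h' (Sum.inr a)
  · intro e he
    simp only [mem_filter, mem_univ, true_and] at he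
    obtain ⟨rfl, rfl⟩ := he
    have s1 : ∀ a : {a // partF e a = none}, ∃ c : {c // ∀ b, partG e b ≠ some c},
        e (Sum.inl a.1) = Sum.inl c.1 := by
      rintro ⟨a, ha⟩
      simp only [partF, Sum.getRight?_eq_none_iff, Sum.isLeft_iff] at ha
      obtain ⟨c, hc⟩ := ha
      refine ⟨⟨c, fun b hb => ?_⟩, hc⟩
      simp only [partG, Sum.getLeft?_eq_some_iff] at hb
      simpa using e.injective (hc.trans hb.symm)
    have s2 : ∀ a : {a // partG e a = none}, ∃ c : {c // ∀ b, partF e b ≠ some c},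
        e (Sum.inr a.1) = Sum.inr c.1 := by
      rintro ⟨a, ha⟩
      simp only [partG, Sum.getLeft?_eq_none_iff, Sum.isRight_iff] at ha
      obtain ⟨c, hc⟩ := ha
      refine ⟨⟨c, fun b hb => ?_⟩, hc⟩
      simp only [partF, Sum.getRight?_eq_some_iff] at hb
      simpa using e.injective (hc.trans hb.symm)
    choose σ hσ using s1
    choose τ hτ using s2
    refine ⟨⟨⟨σ, fun x y h => ?_⟩, ⟨τ, fun x y h => ?_⟩⟩, mem_univ _, ?_⟩
    · have := (hσ x).trans ((congrArg (fun z => Sum.inl z.1) h).trans (hσ y).symm)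
      exact Subtype.ext (Sum.inl.inj (e.injective this))
    · have := (hτ x).trans ((congrArg (fun z => Sum.inr z.1) h).trans (hτ y).symm)
      exact Subtype.ext (Sum.inr.inj (e.injective this))
    · ext x
      rcases x with a | b
      · simp only [Equiv.ofBijective_apply, glue]
        split_ifs with h
        · exact (hσ ⟨a, h⟩).symm
        · rcases h' : e (Sum.inl a) with c | d
          · simp [partF, h'] at h
          · simp [partF, h']
      · simp only [Equiv.ofBijective_apply, glue]
        split_ifs with h
        · exact (hτ ⟨b, h⟩).symm
        · rcases h' : e (Sum.inr b) with c | d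
          · simp [partG, h']
          · simp [partG, h'] at h

/-- Rows. -/
def rowE (n k : ℕ) : Fin k ⊕ Fin n ≃ Fin (n + k) :=
  ((Equiv.refl (Fin k)).sumCongr Fin.revPerm).trans (finSumFinEquiv.trans (finCongr (add_comm k n)))
/-- Columns. -/
def colE (n k : ℕ) : Fin n ⊕ Fin k ≃ Fin (n + k) :=
  (Fin.revPerm.sumCongr (Equiv.refl (Fin k))).trans finSumFinEquiv

theorem vesz_iff (n k : ℕ) (e : Fin k ⊕ Fin n ≃ Fin n ⊕ Fin k) :
    IsVesztergombi n k ((Equiv.equivCongr (rowE n k) (colE n k)) e) ↔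
      StairPI (partF e) ∧ StairPI (partG e) := by
  have i1 : ∀ a a' d, partF e a = some d → partF e a' = some d → a = a' := by
    intro a a' d h h'
    simp only [partF, Sum.getRight?_eq_some_iff] at h h'
    simpa using e.injective (h.trans h'.symm)
  have i2 : ∀ a a' d, partG e a = some d → partG e a' = some d → a = a' := by
    intro a a' d h h'
    simp only [partG, Sum.getLeft?_eq_some_iff] at h h'
    simpa using e.injective (h.trans h'.symm)
  have r1 : ∀ a, (rowE n k (Sum.inl a)).val = a.val := by intro a; simp [rowE]
  have r2 : ∀ b, (rowE n k (Sum.inr b)).val = k + (n - (b.val + 1)) := by intro a; simp [rowE, add_comm]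
  have c1 : ∀ a, (colE n k (Sum.inl a)).val = n - (a.val + 1) := by intro a; simp [colE]
  have c2 : ∀ a, (colE n k (Sum.inr a)).val = n + a.val := by intro a; simp [colE]
  unfold IsVesztergombi StairPI
  rw [← (rowE n k).forall_congr_right, Sum.forall]
  simp only [Equiv.equivCongr_apply_apply, Equiv.symm_apply_apply]
  refine and_congr ?_ ?_
  · refine Iff.trans ?_ (and_iff_right i1).symm
    refine forall_congr' fun a => ?_
    rw [r1]
    rcases h : e (Sum.inl a) with c | d
    · simp only [partF, h, c1]; simp; omega
    · simp only [partF, h, c2]; simp; omega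
  · refine Iff.trans ?_ (and_iff_right i2).symm
    refine forall_congr' fun a => ?_
    rw [r2]
    rcases h : e (Sum.inr a) with c | d
    · simp only [partG, h, c1]; simp; omega
    · simp only [partG, h, c2]; simp; omega

/-- The number of Vesztergombi permutations of `{1, …, n+k}` equals
`∑_{m=0}^{min(n,k)} m! S(n+1, m+1) m! S(k+1, m+1)`. -/
theorem card_vesztergombi_eq (n k : ℕ) :
    (Finset.univ.filter (fun π : Equiv.Perm (Fin (n + k)) => IsVesztergombi n k π)).card
      = ∑ m ∈ Finset.range (min n k + 1),
          m.factorial * stirling (n + 1) (m + 1) * m.factorial * stirling (k + 1) (m + 1) := by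
  have h0 : (Finset.univ.filter (fun π : Equiv.Perm (Fin (n + k)) => IsVesztergombi n k π)).card
      = (univ.filter (fun e : Fin k ⊕ Fin n ≃ Fin n ⊕ Fin k =>
          StairPI (partF e) ∧ StairPI (partG e))).card := by
    rw [Finset.card_filter, Finset.card_filter,
      ← (Equiv.equivCongr (rowE n k) (colE n k)).sum_comp]
    simp only [vesz_iff]
  rw [h0]
  set RK := univ.filter (fun f : Fin k → Option (Fin k) => StairPI f) with hRK
  set RN := univ.filter (fun f : Fin n → Option (Fin n) => StairPI f) with hRN
  rw [Finset.card_eq_sum_card_fiberwise (f := fun e => (partF e, partG e)) (t := RK ×ˢ RN)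
    (by intro e he; simpa [hRK, hRN] using he)]
  have h1 : ∀ p ∈ RK ×ˢ RN, ((univ.filter (fun e : Fin k ⊕ Fin n ≃ Fin n ⊕ Fin k =>
          StairPI (partF e) ∧ StairPI (partG e))).filter
          (fun e => (partF e, partG e) = p)).card =
      if nones p.1 = nones p.2 then (nones p.1).factorial * (nones p.1).factorial else 0 := by
    rintro ⟨f, g⟩ hp
    simp only [hRK, hRN, mem_product, mem_filter, mem_univ, true_and] at hp
    rw [← card_fiber (by simp) (by simp) f g hp.1.1 hp.2.1, Finset.filter_filter]
    congr 1
    ext e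
    simp only [mem_filter, mem_univ, true_and, Prod.mk.injEq]
    constructor
    · exact fun h => h.2
    · rintro ⟨rfl, rfl⟩; exact ⟨hp, rfl, rfl⟩
  rw [Finset.sum_congr rfl h1, Finset.sum_product]
  have h2 : ∀ f : Fin k → Option (Fin k), (∑ g ∈ RN, if nones f = nones g then
      (nones f).factorial * (nones f).factorial else 0) =
      (nones f).factorial * stirling (n + 1) (nones f + 1) * (nones f).factorial := by
    intro f
    rw [← card_stair n n (nones f) le_rfl, ← Finset.sum_filter, Finset.sum_const, hRN,
      Finset.filter_filter]
    simp only [eq_comm (a := nones f), smul_eq_mul]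
    ring
  simp only [h2]
  rw [← Finset.sum_fiberwise_of_maps_to (s := RK) (t := range (k + 1)) (g := fun f => nones f)
    (by
      intro f _
      rw [mem_range, Nat.lt_succ_iff]
      exact (Finset.card_le_univ _).trans (by simp))]
  have h3 : ∀ m ∈ range (k+1), (∑ f ∈ RK with nones f = m,
      (nones f).factorial * stirling (n + 1) (nones f + 1) * (nones f).factorial) =
      m.factorial * stirling (n + 1) (m + 1) * m.factorial * stirling (k + 1) (m + 1) := by
    intro m _
    rw [Finset.sum_congr rfl (g := fun _ => m.factorial * stirling (n + 1) (m + 1) * m.factorial)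
      (by intro f hf; rw [(mem_filter.1 hf).2]), Finset.sum_const, hRK, Finset.filter_filter,
      card_stair k k m le_rfl, smul_eq_mul, mul_comm]
  rw [Finset.sum_congr rfl h3]
  symm
  refine Finset.sum_subset (by intro m; simp only [mem_range]; omega) ?_
  intro m hm hm'
  simp only [mem_range] at hm hm'
  rw [stirling_zero_of_lt (n+1) (m+1) (by omega)]
  simp
end

section
/- For all n, k ≥ 0, the inversion generating polynomial pB_{n,k}(q) := ∑_{π ∈ V_n^k} q^{inv(π)} satisfies pB_{n,k}(q) = q^{nk} · ∑_{m=0}^{min(n,k)} S_{n+1, m+1}(1/q) · S_{k+1, m+1}(1/q) · ([m]!_q)^2 · q^m, as an identity in the field ℚ(q) of rational functions (equivalently, for every real q ≠ 0). -/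
open Finset

attribute [local instance] Classical.propDecidable

/-- The q-integer `[n]_q = 1 + q + ⋯ + q^(n-1)`. -/
def qInt {R : Type*} [CommSemiring R] (q : R) (n : ℕ) : R :=
  ∑ i ∈ Finset.range n, q ^ i

/-- The q-factorial `[n]!_q = [1]_q [2]_q ⋯ [n]_q`. -/
def qFact {R : Type*} [CommSemiring R] (q : R) (n : ℕ) : R :=
  ∏ i ∈ Finset.range n, qInt q (i + 1)

/-- The q-Stirling numbers `S_{n,k}(q)` defined by the recurrence
`S_{n+1,k}(q) = q^(k-1) S_{n,k-1}(q) + [k]_q S_{n,k}(q)`, with `S_{0,0} = 1`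
and `S_{n,k} = 0` for `k > n`. -/
def qStirS {R : Type*} [CommSemiring R] (q : R) : ℕ → ℕ → R
  | 0, 0 => 1
  | 0, _ + 1 => 0
  | _ + 1, 0 => 0
  | n + 1, k + 1 => q ^ k * qStirS q n k + qInt q (k + 1) * qStirS q n (k + 1)

/-- The number of inversions of a permutation: pairs `i < j` with `π(i) > π(j)`. -/
def inversions {N : ℕ} (π : Equiv.Perm (Fin N)) : ℕ :=
  ((Finset.univ ×ˢ Finset.univ).filter
    (fun p : Fin N × Fin N => p.1 < p.2 ∧ π p.2 < π p.1)).card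

/-- Cross inversions between two sets. -/
def crossInv (T U : Finset ℕ) : ℕ := ∑ a ∈ T, ∑ b ∈ U, if b < a then 1 else 0

/-- Inversions of a function. -/
def finv {N : ℕ} (f : Fin N → ℕ) : ℕ := ∑ i, ∑ j, if i < j ∧ f j < f i then 1 else 0

/-- Sum over bijections from rows to a set of columns, built row by row. -/
noncomputable def ZZ (q : ℝ) : ℕ → (ℕ → ℕ → ℝ) → Finset ℕ → ℝ
  | 0, _, _ => 1
  | N + 1, w, U => ∑ t ∈ U, q ^ (∑ b ∈ U, if b < t then 1 else 0) * w 0 t *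
      ZZ q N (fun i => w (i + 1)) (U.erase t)

/-- Sum over injective functions. -/
noncomputable def XX (q : ℝ) (N : ℕ) (w : ℕ → ℕ → ℝ) (U : Finset ℕ) : ℝ :=
  ∑ f ∈ (Fintype.piFinset (fun _ : Fin N => U)).filter Function.Injective,
    q ^ finv f * ∏ i : Fin N, w i (f i)

lemma finv_cons {N : ℕ} (t : ℕ) (g : Fin N → ℕ) :
    finv (Fin.cons t g : Fin (N+1) → ℕ) = (∑ j, if g j < t then 1 else 0) + finv g := by
  simp [finv, Fin.sum_univ_succ, -Finset.sum_boole]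

lemma image_eq_of_inj {N : ℕ} {U : Finset ℕ} (hU : U.card = N) {g : Fin N → ℕ}
    (hg : ∀ i, g i ∈ U) (hi : Function.Injective g) : Finset.univ.image g = U := by
  apply Finset.eq_of_subset_of_card_le
  · intro x hx
    simp only [Finset.mem_image, Finset.mem_univ, true_and] at hx
    obtain ⟨i, rfl⟩ := hx
    exact hg i
  · rw [Finset.card_image_of_injective _ hi]; simp [hU]

lemma XX_succ (q : ℝ) (N : ℕ) (w : ℕ → ℕ → ℝ) (U : Finset ℕ) (hU : U.card = N + 1) :
    XX q (N + 1) w U = ∑ t ∈ U, q ^ (∑ b ∈ U, if b < t then 1 else 0) * w 0 t *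
      XX q N (fun i => w (i + 1)) (U.erase t) := by
  unfold XX
  simp_rw [Finset.mul_sum]
  rw [Finset.sum_sigma']
  refine Finset.sum_bij' (fun f _ => (⟨f 0, Fin.tail f⟩ : (_ : ℕ) × (Fin N → ℕ)))
    (fun p _ => Fin.cons p.1 p.2) ?_ ?_ ?_ ?_ ?_
  · intro f hf
    simp only [Finset.mem_filter, Fintype.mem_piFinset] at hf
    simp only [Finset.mem_sigma, Finset.mem_filter, Fintype.mem_piFinset, Finset.mem_erase, Fin.tail]
    refine ⟨hf.1 0, fun i => ⟨fun h => ?_, hf.1 _⟩, fun a b h => ?_⟩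
    · exact absurd (hf.2 h) (Fin.succ_ne_zero i)
    · exact Fin.succ_injective _ (hf.2 h)
  · rintro ⟨t, g⟩ hp
    simp only [Finset.mem_sigma, Finset.mem_filter, Fintype.mem_piFinset, Finset.mem_erase] at hp
    simp only [Finset.mem_filter, Fintype.mem_piFinset]
    refine ⟨fun i => ?_, ?_⟩
    · refine Fin.cases ?_ (fun j => ?_) i
      · simpa using hp.1
      · simpa using (hp.2.1 j).2
    · rw [Fin.cons_injective_iff]
      refine ⟨?_, hp.2.2⟩
      rintro ⟨j, hj⟩
      exact (hp.2.1 j).1 hj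
  · intro f _
    exact Fin.cons_self_tail f
  · rintro ⟨t, g⟩ _
    simp
  · intro f hf
    simp only [Finset.mem_filter, Fintype.mem_piFinset] at hf
    have h1 : finv f = (∑ j, if Fin.tail f j < f 0 then 1 else 0) + finv (Fin.tail f) := by
      conv_lhs => rw [← Fin.cons_self_tail f]
      exact finv_cons _ _
    have h2 : (∑ b ∈ U, if b < f 0 then 1 else 0) = ∑ j, if Fin.tail f j < f 0 then 1 else 0 := by
      rw [← image_eq_of_inj hU hf.1 hf.2, Finset.sum_image (fun a _ b _ h => hf.2 h),
        Fin.sum_univ_succ]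
      simp only [lt_self_iff_false, if_false, zero_add]
      rfl
    rw [h1, h2, pow_add, Fin.prod_univ_succ]
    simp only [Fin.tail, Fin.val_zero, Fin.val_succ]
    ring

lemma XX_eq_ZZ (q : ℝ) (N : ℕ) : ∀ (w : ℕ → ℕ → ℝ) (U : Finset ℕ), U.card = N →
    XX q N w U = ZZ q N w U := by
  induction N with
  | zero =>
    intro w U hU
    simp only [XX, ZZ, finv]
    rw [Finset.sum_eq_card_nsmul (b := 1)]
    · have : (Fintype.piFinset (fun _ : Fin 0 => U)).filter Function.Injective = {Fin.elim0} := by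
        ext f
        simp only [Finset.mem_filter, Fintype.mem_piFinset, Finset.mem_singleton]
        constructor
        · intro _; exact Subsingleton.elim _ _
        · intro _; exact ⟨fun i => i.elim0, fun i => i.elim0⟩
      rw [this]; simp
    · intro f _; simp
  | succ N ih =>
    intro w U hU
    rw [XX_succ q N w U hU, ZZ]
    refine Finset.sum_congr rfl fun t ht => ?_
    rw [ih _ _ (by rw [Finset.card_erase_of_mem ht, hU]; rfl)]

lemma perm_sum_eq_ZZ (n k : ℕ) (q : ℝ) :
    (∑ π ∈ Finset.univ.filter (fun π : Equiv.Perm (Fin (n + k)) => IsVesztergombi n k π),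
        q ^ inversions π)
      = ZZ q (n + k) (fun i j => if j ≤ i + n ∧ i ≤ j + k then 1 else 0) (Finset.range (n + k)) := by
  rw [← XX_eq_ZZ _ _ _ _ (Finset.card_range _), XX, Finset.sum_filter]
  refine Finset.sum_bij (fun π _ => fun i => ((π i : Fin (n+k)) : ℕ)) ?_ ?_ ?_ ?_
  · intro π _
    simp only [Finset.mem_filter, Fintype.mem_piFinset, Finset.mem_range]
    exact ⟨fun i => (π i).2, fun a b h => π.injective (Fin.ext h)⟩
  · intro π _ σ _ h
    ext i
    exact congrFun h i
  · intro f hf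
    simp only [Finset.mem_filter, Fintype.mem_piFinset, Finset.mem_range] at hf
    have hinj : Function.Injective (fun i => (⟨f i, hf.1 i⟩ : Fin (n+k))) := by
      intro a b h
      exact hf.2 (by simpa using h)
    exact ⟨Equiv.ofBijective _ (Finite.injective_iff_bijective.1 hinj), Finset.mem_univ _, rfl⟩
  · intro π _
    have h1 : finv (fun i => ((π i : Fin (n+k)) : ℕ)) = inversions π := by
      rw [finv, inversions, Finset.card_filter, Finset.sum_product]
      refine Finset.sum_congr rfl fun i _ => Finset.sum_congr rfl fun j _ => ?_
      simp only [Fin.lt_def]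
    rw [h1]
    by_cases h : IsVesztergombi n k π
    · rw [if_pos h, Finset.prod_eq_one, mul_one]
      intro i _
      have h' := h i
      rw [if_pos]
      constructor <;> dsimp only <;> omega
    · rw [if_neg h]
      unfold IsVesztergombi at h
      push Not at h
      obtain ⟨i, hi⟩ := h
      rw [Finset.prod_eq_zero (Finset.mem_univ i), mul_zero]
      rw [if_neg]
      rintro ⟨h1, h2⟩
      dsimp only at h1 h2
      have := hi (by omega)
      omega

lemma crossInv_insert_left {a : ℕ} {T U : Finset ℕ} (h : a ∉ T) :
    crossInv (insert a T) U = (∑ b ∈ U, if b < a then 1 else 0) + crossInv T U := by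
  rw [crossInv, Finset.sum_insert h, crossInv]

lemma crossInv_insert_right {a : ℕ} {T U : Finset ℕ} (h : a ∉ U) :
    crossInv T (insert a U) = (∑ t ∈ T, if a < t then 1 else 0) + crossInv T U := by
  simp only [crossInv, Finset.sum_insert h, Finset.sum_add_distrib]

lemma laplace (q : ℝ) (b : ℕ) (a : ℕ) : ∀ (w : ℕ → ℕ → ℝ) (U : Finset ℕ),
    ZZ q (a + b) w U = ∑ T ∈ U.powersetCard a, q ^ crossInv T (U \ T) * ZZ q a w T *
      ZZ q b (fun i => w (i + a)) (U \ T) := by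
  induction a with
  | zero =>
    intro w U
    simp [crossInv, ZZ]
  | succ a ih =>
    intro w U
    rw [show a + 1 + b = (a + b) + 1 by ring, ZZ]
    simp_rw [ih, ZZ, Finset.mul_sum, Finset.sum_mul]
    rw [Finset.sum_sigma', Finset.sum_sigma']
    refine Finset.sum_bij' (fun p _ => (⟨insert p.1 p.2, p.1⟩ : (_ : Finset ℕ) × ℕ))
      (fun p _ => (⟨p.2, p.1.erase p.2⟩ : (_ : ℕ) × Finset ℕ)) ?_ ?_ ?_ ?_ ?_
    · rintro ⟨t, T⟩ h
      simp only [Finset.mem_sigma, Finset.mem_powersetCard] at h ⊢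
      have ht : t ∉ T := fun h' => by simpa using h.2.1 h'
      refine ⟨⟨?_, ?_⟩, Finset.mem_insert_self _ _⟩
      · exact Finset.insert_subset h.1 (h.2.1.trans (Finset.erase_subset _ _))
      · rw [Finset.card_insert_of_notMem ht, h.2.2]
    · rintro ⟨T, t⟩ h
      simp only [Finset.mem_sigma, Finset.mem_powersetCard] at h ⊢
      refine ⟨h.1.1 h.2, Finset.erase_subset_erase _ h.1.1, ?_⟩
      rw [Finset.card_erase_of_mem h.2, h.1.2]; rfl
    · rintro ⟨t, T⟩ h
      simp only [Finset.mem_sigma, Finset.mem_powersetCard] at h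
      have ht : t ∉ T := fun h' => by simpa using h.2.1 h'
      simp [Finset.erase_insert ht]
    · rintro ⟨T, t⟩ h
      simp only [Finset.mem_sigma, Finset.mem_powersetCard] at h
      simp [Finset.insert_erase h.2]
    · rintro ⟨t, T⟩ h
      simp only [Finset.mem_sigma, Finset.mem_powersetCard] at h
      have ht : t ∉ T := fun h' => by simpa using h.2.1 h'
      have hs : U.erase t \ T = U \ insert t T := by
        ext x; simp only [Finset.mem_sdiff, Finset.mem_erase, Finset.mem_insert]; tauto
      have hsub : insert t T ⊆ U :=
        Finset.insert_subset h.1 (h.2.1.trans (Finset.erase_subset _ _))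
      simp only [hs, Finset.erase_insert ht]
      rw [crossInv_insert_left ht, ← Finset.sum_sdiff hsub, pow_add, pow_add]
      have : (fun i => w (i + a + 1)) = (fun i => w (i + (a + 1))) := rfl
      rw [this]
      ring

lemma ZZ_last (q : ℝ) (a : ℕ) (w : ℕ → ℕ → ℝ) (U : Finset ℕ) (hU : U.card = a + 1) :
    ZZ q (a + 1) w U = ∑ t ∈ U, q ^ (∑ b ∈ U, if t < b then 1 else 0) * w a t *
      ZZ q a w (U.erase t) := by
  rw [laplace]
  symm
  refine Finset.sum_bij (fun t _ => U.erase t) ?_ ?_ ?_ ?_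
  · intro t ht
    rw [Finset.mem_powersetCard, Finset.card_erase_of_mem ht, hU]
    exact ⟨Finset.erase_subset _ _, rfl⟩
  · intro s hs t ht h
    by_contra hne
    have : s ∈ U.erase t := Finset.mem_erase.2 ⟨hne, hs⟩
    rw [← h] at this
    simp at this
  · intro T hT
    rw [Finset.mem_powersetCard] at hT
    have h1 : (U \ T).card = 1 := by rw [Finset.card_sdiff_of_subset hT.1]; omega
    obtain ⟨t, ht⟩ := Finset.card_eq_one.1 h1
    have htU : t ∈ U \ T := by rw [ht]; simp
    rw [Finset.mem_sdiff] at htU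
    refine ⟨t, htU.1, ?_⟩
    rw [Finset.erase_eq, ← ht, Finset.sdiff_sdiff_eq_self hT.1]
  · intro t ht
    have h1 : U \ U.erase t = {t} := by
      ext x; simp only [Finset.mem_sdiff, Finset.mem_erase, Finset.mem_singleton]
      constructor
      · tauto
      · rintro rfl; tauto
    rw [h1]
    have h2 : crossInv (U.erase t) {t} = ∑ b ∈ U, if t < b then 1 else 0 := by
      conv_rhs => rw [← Finset.insert_erase ht]
      rw [Finset.sum_insert (by simp)]
      simp [crossInv, -Finset.sum_boole]
    rw [h2]
    simp [ZZ, -Finset.sum_boole]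
    ring

lemma sum_rank_lt (q : ℝ) (S : Finset ℕ) :
    ∑ t ∈ S, q ^ (∑ b ∈ S, if b < t then 1 else 0) = qInt q S.card := by
  induction S using Finset.induction_on_max with
  | empty => simp [qInt]
  | insert a s hs ih =>
    have ha : a ∉ s := fun h => lt_irrefl _ (hs a h)
    rw [Finset.sum_insert ha, Finset.card_insert_of_notMem ha, qInt, Finset.sum_range_succ,
      ← qInt, ← ih, add_comm]
    congr 1
    · refine Finset.sum_congr rfl fun t ht => ?_
      rw [Finset.sum_insert ha, if_neg (not_lt.2 (hs t ht).le), zero_add]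
    · rw [Finset.sum_insert ha, if_neg (lt_irrefl _), zero_add,
        Finset.sum_congr rfl (fun b hb => if_pos (hs b hb))]
      simp

lemma sum_rank_gt (q : ℝ) (S : Finset ℕ) :
    ∑ t ∈ S, q ^ (∑ b ∈ S, if t < b then 1 else 0) = qInt q S.card := by
  induction S using Finset.induction_on_min with
  | empty => simp [qInt]
  | insert a s hs ih =>
    have ha : a ∉ s := fun h => lt_irrefl _ (hs a h)
    rw [Finset.sum_insert ha, Finset.card_insert_of_notMem ha, qInt, Finset.sum_range_succ,
      ← qInt, ← ih, add_comm]
    congr 1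
    · refine Finset.sum_congr rfl fun t ht => ?_
      rw [Finset.sum_insert ha, if_neg (not_lt.2 (hs t ht).le), zero_add]
    · rw [Finset.sum_insert ha, if_neg (lt_irrefl _), zero_add,
        Finset.sum_congr rfl (fun b hb => if_pos (hs b hb))]
      simp

lemma ZZ_upper (q : ℝ) (k : ℕ) : ∀ (c : ℕ → ℕ) (_ : Monotone c) (T : Finset ℕ),
    ZZ q k (fun i j => if j ≤ c i then 1 else 0) T =
      ∏ i ∈ Finset.range k, qInt q ((T.filter (fun t => t ≤ c i)).card - i) := by
  induction k with
  | zero => intro c _ T; simp [ZZ]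
  | succ k ih =>
    intro c hc T
    rw [ZZ, Finset.prod_range_succ', Nat.sub_zero, ← sum_rank_lt, Finset.mul_sum, Finset.sum_filter]
    refine Finset.sum_congr rfl fun t ht => ?_
    by_cases h : t ≤ c 0
    · rw [if_pos h, if_pos h, ih (fun i => c (i+1)) (fun i j hij => hc (by omega)), mul_one, mul_comm]
      congr 1
      · refine Finset.prod_congr rfl fun i _ => ?_
        have : t ∈ T.filter (fun t => t ≤ c (i+1)) :=
          Finset.mem_filter.2 ⟨ht, h.trans (hc (by omega))⟩
        rw [Finset.filter_erase, Finset.card_erase_of_mem this]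
        congr 1; omega
      · congr 1
        rw [Finset.sum_filter]
        refine Finset.sum_congr rfl fun b _ => ?_
        by_cases hb : b < t
        · rw [if_pos hb, if_pos (hb.le.trans h)]
        · rw [if_neg hb]; simp
    · rw [if_neg h, if_neg h]; simp

lemma ZZ_lower (q : ℝ) (k : ℕ) (c : ℕ → ℕ) (hc : Monotone c) : ∀ (T : Finset ℕ), T.card = k →
    ZZ q k (fun i j => if c i ≤ j then 1 else 0) T =
      ∏ i ∈ Finset.range k, qInt q ((T.filter (fun t => c i ≤ t)).card - (k - 1 - i)) := by
  induction k with
  | zero => intro T _; simp [ZZ]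
  | succ k ih =>
    intro T hT
    rw [ZZ_last _ _ _ _ hT, Finset.prod_range_succ, show k + 1 - 1 - k = 0 by omega,
      Nat.sub_zero, ← sum_rank_gt, Finset.mul_sum, Finset.sum_filter]
    refine Finset.sum_congr rfl fun t ht => ?_
    by_cases h : c k ≤ t
    · rw [if_pos h, if_pos h, ih _ (by rw [Finset.card_erase_of_mem ht, hT]; rfl), mul_one, mul_comm]
      congr 1
      · refine Finset.prod_congr rfl fun i hi => ?_
        rw [Finset.mem_range] at hi
        have : t ∈ T.filter (fun t => c i ≤ t) :=
          Finset.mem_filter.2 ⟨ht, (hc hi.le).trans h⟩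
        rw [Finset.filter_erase, Finset.card_erase_of_mem this]
        congr 1; omega
      · congr 1
        rw [Finset.sum_filter]
        refine Finset.sum_congr rfl fun b _ => ?_
        by_cases hb : t < b
        · rw [if_pos hb, if_pos (h.trans hb.le)]
        · rw [if_neg hb]; simp
    · rw [if_neg h, if_neg h]; simp

/-- The common one-sided generating function. -/
noncomputable def Fr (q : ℝ) : ℕ → ℕ → ℝ
  | 0, 0 => 1
  | 0, _ + 1 => 0
  | L + 1, 0 => Fr q L 0
  | L + 1, m + 1 => qInt q (m + 2) * Fr q L (m + 1) + q ^ (L - m) * qInt q (m + 1) * Fr q L m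


lemma sum_powersetCard_insert (f : Finset ℕ → ℝ) (a m : ℕ) (D : Finset ℕ) (ha : a ∉ D) :
    ∑ U ∈ (insert a D).powersetCard (m + 1), f U =
      ∑ U ∈ D.powersetCard (m + 1), f U + ∑ U ∈ D.powersetCard m, f (insert a U) := by
  rw [Finset.powersetCard_succ_insert ha, Finset.sum_union, Finset.sum_image]
  · intro U hU V hV h
    have hU' : a ∉ U := fun h => ha ((Finset.mem_powersetCard.1 hU).1 h)
    have hV' : a ∉ V := fun h => ha ((Finset.mem_powersetCard.1 hV).1 h)
    rw [← Finset.erase_insert hU', h, Finset.erase_insert hV']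
  · rw [Finset.disjoint_left]
    intro U hU hU'
    obtain ⟨V, _, rfl⟩ := Finset.mem_image.1 hU'
    exact ha ((Finset.mem_powersetCard.1 hU).1 (Finset.mem_insert_self _ _))

lemma insert_sdiff_aux {a : ℕ} {D U : Finset ℕ} (ha : a ∉ D) (hU : U ⊆ D) :
    insert a D \ U = insert a (D \ U) :=
  Finset.insert_sdiff_of_notMem _ (fun h => ha (hU h))

lemma insert_sdiff_insert_aux {a : ℕ} {D U : Finset ℕ} (ha : a ∉ D) :
    insert a D \ insert a U = D \ U := by
  ext x
  simp only [Finset.mem_sdiff, Finset.mem_insert]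
  constructor
  · tauto
  · rintro ⟨h1, h2⟩
    refine ⟨Or.inr h1, ?_⟩
    rintro (rfl | h)
    · exact ha h1
    · exact h2 h

/-- Summand for the top half. -/
noncomputable def fT (q : ℝ) (L a m : ℕ) (D U : Finset ℕ) : ℝ :=
  q ^ crossInv (D \ U) U *
    ∏ i ∈ Finset.range L, qInt q (m + ((D \ U).filter (fun t => t ≤ a + i)).card - i)

lemma fT_A (q : ℝ) (L a m : ℕ) (D U : Finset ℕ) (hD : ∀ x ∈ D, a < x) (hU : U ⊆ D) :
    fT q (L + 1) a m (insert a D) U = qInt q (m + 1) * fT q L (a + 1) m D U := by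
  have ha : a ∉ D := fun h => lt_irrefl _ (hD a h)
  have ha' : a ∉ D \ U := fun h => ha (Finset.mem_sdiff.1 h).1
  unfold fT
  rw [insert_sdiff_aux ha hU, crossInv_insert_left ha', Finset.prod_range_succ']
  have h0 : (∑ b ∈ U, if b < a then 1 else 0) = 0 :=
    Finset.sum_eq_zero fun b hb => if_neg (not_lt.2 (hD b (hU hb)).le)
  have h1 : ((insert a (D \ U)).filter (fun t => t ≤ a + 0)).card = 1 := by
    rw [Finset.card_eq_one]
    refine ⟨a, ?_⟩
    ext x
    simp only [Finset.mem_filter, Finset.mem_insert, Finset.mem_singleton, Finset.mem_sdiff]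
    constructor
    · rintro ⟨rfl | h, h2⟩
      · rfl
      · have := hD x h.1; omega
    · rintro rfl; simp
  have h2 : ∀ i ∈ Finset.range L,
      qInt q (m + ((insert a (D \ U)).filter (fun t => t ≤ a + (i + 1))).card - (i + 1)) =
      qInt q (m + ((D \ U).filter (fun t => t ≤ a + 1 + i)).card - i) := by
    intro i _
    rw [Finset.filter_insert, if_pos (by omega), Finset.card_insert_of_notMem
      (fun h => ha' (Finset.mem_filter.1 h).1)]
    have : (fun t => t ≤ a + (i + 1)) = (fun t => t ≤ a + 1 + i) := by
      funext t; rw [show a + (i + 1) = a + 1 + i by omega]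
    simp only [this]
    congr 1; omega
  rw [h0, h1, Finset.prod_congr rfl h2, zero_add, Nat.sub_zero]
  ring

lemma fT_B (q : ℝ) (L a m : ℕ) (D U : Finset ℕ) (hD : ∀ x ∈ D, a < x) (hU : U ⊆ D) :
    fT q (L + 1) a (m + 1) (insert a D) (insert a U) =
      q ^ (D \ U).card * qInt q (m + 1) * fT q L (a + 1) m D U := by
  have ha : a ∉ D := fun h => lt_irrefl _ (hD a h)
  have haU : a ∉ U := fun h => ha (hU h)
  unfold fT
  rw [insert_sdiff_insert_aux ha, crossInv_insert_right haU, Finset.prod_range_succ']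
  have h0 : (∑ t ∈ D \ U, if a < t then 1 else 0) = (D \ U).card := by
    rw [Finset.sum_congr rfl (fun t ht => if_pos (hD t (Finset.mem_sdiff.1 ht).1))]
    simp
  have h1 : ((D \ U).filter (fun t => t ≤ a + 0)).card = 0 := by
    rw [Finset.card_eq_zero, Finset.filter_eq_empty_iff]
    intro x hx
    have := hD x (Finset.mem_sdiff.1 hx).1
    omega
  have h2 : ∀ i ∈ Finset.range L,
      qInt q (m + 1 + ((D \ U).filter (fun t => t ≤ a + (i + 1))).card - (i + 1)) =
      qInt q (m + ((D \ U).filter (fun t => t ≤ a + 1 + i)).card - i) := by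
    intro i _
    have : (fun t => t ≤ a + (i + 1)) = (fun t => t ≤ a + 1 + i) := by
      funext t; rw [show a + (i + 1) = a + 1 + i by omega]
    simp only [this]
    congr 1; omega
  rw [h0, h1, Finset.prod_congr rfl h2, Nat.sub_zero, add_zero, pow_add]
  ring

lemma sum_fT (q : ℝ) (L : ℕ) : ∀ a m : ℕ,
    ∑ U ∈ (Finset.Ico a (a + L)).powersetCard m, fT q L a m (Finset.Ico a (a + L)) U = Fr q L m := by
  induction L with
  | zero =>
    intro a m
    cases m with
    | zero => simp [fT, Fr, crossInv]
    | succ m =>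
      rw [Finset.powersetCard_eq_empty.2 (by simp)]
      simp [Fr]
  | succ L ih =>
    intro a m
    have hI : Finset.Ico a (a + (L + 1)) = insert a (Finset.Ico (a + 1) (a + 1 + L)) := by
      ext x; simp only [Finset.mem_Ico, Finset.mem_insert]; omega
    have hD : ∀ x ∈ Finset.Ico (a + 1) (a + 1 + L), a < x := by
      intro x hx; rw [Finset.mem_Ico] at hx; omega
    rw [hI]
    cases m with
    | zero =>
      have := ih (a + 1) 0
      rw [Finset.powersetCard_zero, Finset.sum_singleton] at this ⊢
      rw [fT_A _ _ _ _ _ _ hD (Finset.empty_subset _), this, Fr]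
      simp [qInt]
    | succ m =>
      rw [sum_powersetCard_insert _ _ _ _ (fun h => lt_irrefl _ (hD a h)), Fr, ← ih (a + 1) (m + 1),
        ← ih (a + 1) m, Finset.mul_sum, Finset.mul_sum]
      congr 1
      · refine Finset.sum_congr rfl fun U hU => ?_
        exact fT_A _ _ _ _ _ _ hD (Finset.mem_powersetCard.1 hU).1
      · refine Finset.sum_congr rfl fun U hU => ?_
        rw [Finset.mem_powersetCard] at hU
        rw [fT_B _ _ _ _ _ _ hD hU.1, Finset.card_sdiff_of_subset hU.1, hU.2, Nat.card_Ico]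
        congr 4
        omega

/-- Summand for the bottom half. -/
noncomputable def fB (q : ℝ) (L m : ℕ) (T : Finset ℕ) : ℝ :=
  q ^ crossInv T (Finset.range L \ T) *
    ∏ i ∈ Finset.range L,
      qInt q (m + ((Finset.range L \ T).filter (fun t => i ≤ t)).card - (L - 1 - i))

lemma range_succ_aux (L : ℕ) : Finset.range (L + 1) = insert L (Finset.range L) := by
  ext x; simp only [Finset.mem_range, Finset.mem_insert]; omega

lemma fB_A (q : ℝ) (L m : ℕ) (T : Finset ℕ) (hT : T ⊆ Finset.range L) :
    fB q (L + 1) m T = qInt q (m + 1) * fB q L m T := by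
  have ha : L ∉ Finset.range L := by simp
  have ha' : L ∉ Finset.range L \ T := fun h => ha (Finset.mem_sdiff.1 h).1
  unfold fB
  rw [Finset.prod_range_succ]
  rw [range_succ_aux, insert_sdiff_aux ha hT, crossInv_insert_right ha']
  have h0 : (∑ t ∈ T, if L < t then 1 else 0) = 0 :=
    Finset.sum_eq_zero fun b hb => if_neg (not_lt.2 (Finset.mem_range.1 (hT hb)).le)
  have h1 : ((insert L (Finset.range L \ T)).filter (fun t => L ≤ t)).card = 1 := by
    rw [Finset.card_eq_one]
    refine ⟨L, ?_⟩
    ext x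
    simp only [Finset.mem_filter, Finset.mem_insert, Finset.mem_singleton, Finset.mem_sdiff,
      Finset.mem_range]
    constructor
    · rintro ⟨rfl | h, h2⟩
      · rfl
      · omega
    · rintro rfl; simp
  have h2 : ∀ i ∈ Finset.range L,
      qInt q (m + ((insert L (Finset.range L \ T)).filter (fun t => i ≤ t)).card - (L + 1 - 1 - i)) =
      qInt q (m + ((Finset.range L \ T).filter (fun t => i ≤ t)).card - (L - 1 - i)) := by
    intro i hi
    rw [Finset.mem_range] at hi
    rw [Finset.filter_insert, if_pos (by omega), Finset.card_insert_of_notMem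
      (fun h => ha' (Finset.mem_filter.1 h).1)]
    congr 1; omega
  rw [h0, h1, Finset.prod_congr rfl h2, zero_add, show L + 1 - 1 - L = 0 by omega, Nat.sub_zero]
  ring

lemma fB_B (q : ℝ) (L m : ℕ) (T : Finset ℕ) (hT : T ⊆ Finset.range L) :
    fB q (L + 1) (m + 1) (insert L T) =
      q ^ (Finset.range L \ T).card * qInt q (m + 1) * fB q L m T := by
  have ha : L ∉ Finset.range L := by simp
  have haT : L ∉ T := fun h => ha (hT h)
  unfold fB
  rw [Finset.prod_range_succ]
  rw [range_succ_aux, insert_sdiff_insert_aux ha, crossInv_insert_left haT]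
  have h0 : (∑ t ∈ Finset.range L \ T, if t < L then 1 else 0) = (Finset.range L \ T).card := by
    rw [Finset.sum_congr rfl
      (fun t ht => if_pos (Finset.mem_range.1 (Finset.mem_sdiff.1 ht).1))]
    simp
  have h1 : ((Finset.range L \ T).filter (fun t => L ≤ t)).card = 0 := by
    rw [Finset.card_eq_zero, Finset.filter_eq_empty_iff]
    intro x hx
    have := Finset.mem_range.1 (Finset.mem_sdiff.1 hx).1
    omega
  have h2 : ∀ i ∈ Finset.range L,
      qInt q (m + 1 + ((Finset.range L \ T).filter (fun t => i ≤ t)).card - (L + 1 - 1 - i)) =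
      qInt q (m + ((Finset.range L \ T).filter (fun t => i ≤ t)).card - (L - 1 - i)) := by
    intro i hi
    rw [Finset.mem_range] at hi
    congr 1; omega
  rw [h0, h1, Finset.prod_congr rfl h2, show L + 1 - 1 - L = 0 by omega, Nat.sub_zero, add_zero,
    pow_add]
  ring

lemma sum_fB (q : ℝ) (L : ℕ) : ∀ m : ℕ,
    ∑ T ∈ (Finset.range L).powersetCard m, fB q L m T = Fr q L m := by
  induction L with
  | zero =>
    intro m
    cases m with
    | zero => simp [fB, Fr, crossInv]
    | succ m =>
      rw [Finset.powersetCard_eq_empty.2 (by simp)]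
      simp [Fr]
  | succ L ih =>
    intro m
    cases m with
    | zero =>
      have := ih 0
      rw [Finset.powersetCard_zero, Finset.sum_singleton] at this ⊢
      rw [fB_A _ _ _ _ (Finset.empty_subset _), this, Fr]
      simp [qInt]
    | succ m =>
      rw [range_succ_aux, sum_powersetCard_insert _ _ _ _ (by simp), Fr, ← ih (m + 1),
        ← ih m, Finset.mul_sum, Finset.mul_sum]
      congr 1
      · refine Finset.sum_congr rfl fun U hU => ?_
        exact fB_A _ _ _ _ (Finset.mem_powersetCard.1 hU).1
      · refine Finset.sum_congr rfl fun U hU => ?_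
        rw [Finset.mem_powersetCard] at hU
        rw [fB_B _ _ _ _ hU.1, Finset.card_sdiff_of_subset hU.1, hU.2, Finset.card_range]

lemma qInt_inv (q : ℝ) (hq : q ≠ 0) (m : ℕ) : q ^ m * qInt q⁻¹ (m + 1) = qInt q (m + 1) := by
  rw [qInt, qInt, Finset.mul_sum, ← Finset.sum_range_reflect]
  refine Finset.sum_congr rfl fun i hi => ?_
  rw [Finset.mem_range] at hi
  have h : m = i + (m + 1 - 1 - i) := by omega
  conv_lhs => rw [h]
  rw [show i + (m + 1 - 1 - i) + 1 - 1 - i = m + 1 - 1 - i by omega, pow_add, mul_assoc, ← mul_pow,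
    mul_inv_cancel₀ hq, one_pow, mul_one]

lemma Fr_zero (q : ℝ) (L : ℕ) : ∀ m, L < m → Fr q L m = 0 := by
  induction L with
  | zero => intro m hm; cases m with
    | zero => omega
    | succ m => simp [Fr]
  | succ L ih => intro m hm; cases m with
    | zero => omega
    | succ m => rw [Fr, ih _ (by omega), ih _ (by omega)]; simp

lemma qStirS_one (p : ℝ) (L : ℕ) : qStirS p (L + 1) 1 = 1 := by
  induction L with
  | zero => simp [qStirS]
  | succ L ih =>
    rw [qStirS, ih]
    simp [qStirS, qInt]

lemma Fr_eq (q : ℝ) (hq : q ≠ 0) (L : ℕ) : ∀ m,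
    q ^ (m.choose 2) * Fr q L m = q ^ (m * L) * qStirS q⁻¹ (L + 1) (m + 1) * qFact q m := by
  induction L with
  | zero =>
    intro m
    cases m with
    | zero => simp [Fr, qStirS, qFact]
    | succ m => simp [Fr, qStirS]
  | succ L ih =>
    intro m
    cases m with
    | zero =>
      have := ih 0
      simpa [Fr, qStirS_one] using this
    | succ m =>
      have h1 := ih (m + 1)
      have h2 := ih m
      have hf : qFact q (m + 1) = qFact q m * qInt q (m + 1) := by
        rw [qFact, Finset.prod_range_succ, ← qFact]
      have hc : (m + 1).choose 2 = m + m.choose 2 := by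
        rw [Nat.choose_succ_succ' m 1, Nat.choose_one_right]
      rw [Fr, qStirS, mul_add]
      have e1 : q ^ ((m + 1).choose 2) * (qInt q (m + 2) * Fr q L (m + 1)) =
          q ^ ((m + 1) * (L + 1)) * (qInt q⁻¹ (m + 1 + 1) * qStirS q⁻¹ (L + 1) (m + 1 + 1)) *
            qFact q (m + 1) := by
        rw [show (m + 1) * (L + 1) = (m + 1) * L + (m + 1) by ring, pow_add,
          ← qInt_inv q hq (m + 1)]
        linear_combination (q ^ (m + 1) * qInt q⁻¹ (m + 1 + 1)) * h1
      have e2 : q ^ ((m + 1).choose 2) * (q ^ (L - m) * qInt q (m + 1) * Fr q L m) =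
          q ^ ((m + 1) * (L + 1)) * ((q⁻¹) ^ (m + 1) * qStirS q⁻¹ (L + 1) (m + 1)) *
            qFact q (m + 1) := by
        have e3 : q ^ ((m + 1) * (L + 1)) * (q⁻¹) ^ (m + 1) = q ^ (m * L) * q ^ L := by
          rw [show (m + 1) * (L + 1) = m * L + L + (m + 1) by ring, pow_add, mul_assoc, ← mul_pow,
            mul_inv_cancel₀ hq, one_pow, mul_one, pow_add]
        rw [← mul_assoc (q ^ ((m + 1) * (L + 1))), e3, hf]
        have e4 : q ^ m * q ^ (L - m) * Fr q L m = q ^ L * Fr q L m := by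
          rcases le_or_gt m L with h | h
          · rw [← pow_add, Nat.add_sub_cancel' h]
          · rw [Fr_zero _ _ _ h]; simp
        rw [hc, pow_add]
        linear_combination (q ^ (m.choose 2) * qInt q (m + 1)) * e4 + (q ^ L * qInt q (m + 1)) * h2
      rw [e1, e2]
      ring

lemma ZZ_congr (q : ℝ) (N : ℕ) : ∀ (w w' : ℕ → ℕ → ℝ) (U : Finset ℕ),
    (∀ i < N, ∀ j ∈ U, w i j = w' i j) → ZZ q N w U = ZZ q N w' U := by
  induction N with
  | zero => intros; rfl
  | succ N ih =>
    intro w w' U h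
    rw [ZZ, ZZ]
    refine Finset.sum_congr rfl fun t ht => ?_
    rw [h 0 (by omega) t ht, ih (fun i => w (i + 1)) (fun i => w' (i + 1)) (U.erase t)]
    intro i hi j hj
    exact h (i + 1) (by omega) j (Finset.mem_of_mem_erase hj)

lemma split_sum (n k : ℕ) (f : Finset ℕ → ℝ) :
    ∑ T ∈ (Finset.range (n + k)).powersetCard k, f T =
      ∑ m ∈ Finset.range (min n k + 1), ∑ A ∈ (Finset.range n).powersetCard m,
        ∑ B ∈ (Finset.Ico n (n + k)).powersetCard m, f (A ∪ (Finset.Ico n (n + k) \ B)) := by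
  have hle : ∀ T ∈ (Finset.range (n + k)).powersetCard k,
      (T ∩ Finset.range n).card ∈ Finset.range (min n k + 1) := by
    intro T hT
    rw [Finset.mem_powersetCard] at hT
    have h1 := Finset.card_le_card (Finset.inter_subset_left (s₁ := T) (s₂ := Finset.range n))
    have h2 := Finset.card_le_card (Finset.inter_subset_right (s₁ := T) (s₂ := Finset.range n))
    rw [Finset.card_range] at h2
    rw [Finset.mem_range]
    omega
  rw [← Finset.sum_fiberwise_of_maps_to hle]
  refine Finset.sum_congr rfl fun m hm => ?_
  rw [Finset.mem_range] at hm
  rw [← Finset.sum_product']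
  refine Finset.sum_bij' (fun T _ => (T ∩ Finset.range n, Finset.Ico n (n + k) \ T))
    (fun p _ => p.1 ∪ (Finset.Ico n (n + k) \ p.2)) ?_ ?_ ?_ ?_ ?_
  · intro T hT
    rw [Finset.mem_filter, Finset.mem_powersetCard] at hT
    rw [Finset.mem_product, Finset.mem_powersetCard, Finset.mem_powersetCard]
    refine ⟨⟨Finset.inter_subset_right, hT.2⟩, Finset.sdiff_subset, ?_⟩
    have h1 := Finset.card_inter_add_card_sdiff T (Finset.range n)
    have h2 : T \ Finset.range n = Finset.Ico n (n + k) ∩ T := by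
      ext x
      simp only [Finset.mem_sdiff, Finset.mem_inter, Finset.mem_Ico, Finset.mem_range]
      constructor
      · rintro ⟨h, h'⟩
        have := Finset.mem_range.1 (hT.1.1 h)
        exact ⟨⟨by omega, this⟩, h⟩
      · rintro ⟨⟨h, _⟩, h'⟩
        exact ⟨h', by omega⟩
    have h3 := Finset.card_inter_add_card_sdiff (Finset.Ico n (n + k)) T
    rw [h2] at h1
    rw [Nat.card_Ico] at h3
    change (Finset.Ico n (n + k) \ T).card = m
    omega
  · rintro ⟨A, B⟩ h
    rw [Finset.mem_product, Finset.mem_powersetCard, Finset.mem_powersetCard] at h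
    dsimp only at h
    obtain ⟨⟨hA, hA'⟩, hB, hB'⟩ := h
    rw [Finset.mem_filter, Finset.mem_powersetCard]
    refine ⟨⟨?_, ?_⟩, ?_⟩
    · intro x hx
      simp only [Finset.mem_union, Finset.mem_sdiff, Finset.mem_Ico] at hx
      rw [Finset.mem_range]
      rcases hx with hx | hx
      · have := Finset.mem_range.1 (hA hx); omega
      · omega
    · rw [Finset.card_union_of_disjoint, Finset.card_sdiff_of_subset hB, hA', hB', Nat.card_Ico]
      · omega
      · rw [Finset.disjoint_left]
        intro x hx hx'
        have := Finset.mem_range.1 (hA hx)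
        have := Finset.mem_Ico.1 (Finset.mem_sdiff.1 hx').1
        omega
    · rw [← hA']
      congr 1
      ext x
      simp only [Finset.mem_inter, Finset.mem_union, Finset.mem_sdiff, Finset.mem_Ico,
        Finset.mem_range]
      constructor
      · rintro ⟨h | h, h'⟩
        · exact h
        · omega
      · intro h
        exact ⟨Or.inl h, Finset.mem_range.1 (hA h)⟩
  · intro T hT
    rw [Finset.mem_filter, Finset.mem_powersetCard] at hT
    ext x
    simp only [Finset.mem_inter, Finset.mem_union, Finset.mem_sdiff, Finset.mem_Ico,
        Finset.mem_range]
    constructor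
    · tauto
    · intro h
      have := Finset.mem_range.1 (hT.1.1 h)
      rcases lt_or_ge x n with h' | h'
      · exact Or.inl ⟨h, h'⟩
      · exact Or.inr ⟨⟨h', this⟩, by tauto⟩
  · rintro ⟨A, B⟩ h
    rw [Finset.mem_product, Finset.mem_powersetCard, Finset.mem_powersetCard] at h
    dsimp only at h
    obtain ⟨⟨hA, hA'⟩, hB, hB'⟩ := h
    ext x
    · simp only [Finset.mem_inter, Finset.mem_union, Finset.mem_sdiff, Finset.mem_Ico,
        Finset.mem_range]
      constructor
      · rintro ⟨h | h, h'⟩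
        · exact h
        · omega
      · intro h
        exact ⟨Or.inl h, Finset.mem_range.1 (hA h)⟩
    · simp only [Finset.mem_union, Finset.mem_sdiff, Finset.mem_Ico]
      constructor
      · tauto
      · intro h
        have h1 := Finset.mem_Ico.1 (hB h)
        refine ⟨h1, ?_⟩
        rintro (h2 | h2)
        · have := Finset.mem_range.1 (hA h2); omega
        · exact h2.2 h
  · intro T hT
    rw [Finset.mem_filter, Finset.mem_powersetCard] at hT
    congr 1
    ext x
    simp only [Finset.mem_inter, Finset.mem_union, Finset.mem_sdiff, Finset.mem_Ico,
        Finset.mem_range]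
    constructor
    · intro h
      have := Finset.mem_range.1 (hT.1.1 h)
      rcases lt_or_ge x n with h' | h'
      · exact Or.inl ⟨h, h'⟩
      · exact Or.inr ⟨⟨h', this⟩, by tauto⟩
    · tauto

lemma crossInv_union_left {T T' U : Finset ℕ} (h : Disjoint T T') :
    crossInv (T ∪ T') U = crossInv T U + crossInv T' U := by
  rw [crossInv, Finset.sum_union h]; rfl

lemma crossInv_union_right {T U U' : Finset ℕ} (h : Disjoint U U') :
    crossInv T (U ∪ U') = crossInv T U + crossInv T U' := by
  simp only [crossInv, Finset.sum_union h, Finset.sum_add_distrib]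

lemma summand_eq (n k m : ℕ) (q : ℝ) (A B : Finset ℕ) (hA : A ⊆ Finset.range n) (hA' : A.card = m)
    (hB : B ⊆ Finset.Ico n (n + k)) (hB' : B.card = m) (hmn : m ≤ n) (hmk : m ≤ k) (T : Finset ℕ)
    (hT : T = A ∪ (Finset.Ico n (n + k) \ B)) :
    q ^ crossInv T (Finset.range (n + k) \ T) *
      ZZ q k (fun i j => if j ≤ i + n ∧ i ≤ j + k then 1 else 0) T *
      ZZ q n (fun i j => if j ≤ i + k + n ∧ i + k ≤ j + k then 1 else 0)
        (Finset.range (n + k) \ T) =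
    q ^ ((n - m) * (k - m)) * (fB q n m A * fT q k n m (Finset.Ico n (n + k)) B) := by
  have hAn : ∀ x ∈ A, x < n := fun x hx => Finset.mem_range.1 (hA hx)
  have hBn : ∀ x ∈ B, n ≤ x ∧ x < n + k := fun x hx => Finset.mem_Ico.1 (hB hx)
  have hTD : ∀ x ∈ Finset.Ico n (n + k) \ B, n ≤ x ∧ x < n + k := fun x hx =>
    Finset.mem_Ico.1 (Finset.mem_sdiff.1 hx).1
  have hUC : ∀ x ∈ Finset.range n \ A, x < n := fun x hx =>
    Finset.mem_range.1 (Finset.mem_sdiff.1 hx).1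
  have d1 : Disjoint A (Finset.Ico n (n + k) \ B) := by
    rw [Finset.disjoint_left]
    intro x hx hx'
    have := hAn x hx; have := hTD x hx'; omega
  have d2 : Disjoint (Finset.range n \ A) B := by
    rw [Finset.disjoint_left]
    intro x hx hx'
    have := hUC x hx; have := hBn x hx'; omega
  have hU : Finset.range (n + k) \ T = (Finset.range n \ A) ∪ B := by
    subst hT
    ext x
    have h1 := hAn x
    have h2 := hBn x
    simp only [Finset.mem_union, Finset.mem_sdiff, Finset.mem_Ico, Finset.mem_range]
    by_cases hxA : x ∈ A
    · have := h1 hxA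
      have : x ∉ B := fun h => by have := h2 h; omega
      tauto
    · by_cases hxB : x ∈ B
      · have := h2 hxB
        tauto
      · simp only [hxA, hxB, false_or, not_false_eq_true, and_true, or_false]
        omega
  have cC : (Finset.range n \ A).card = n - m := by
    rw [Finset.card_sdiff_of_subset hA, hA', Finset.card_range]
  have cD : (Finset.Ico n (n + k) \ B).card = k - m := by
    rw [Finset.card_sdiff_of_subset hB, hB', Nat.card_Ico]; omega
  have hUcard : (Finset.range (n + k) \ T).card = n := by
    rw [hU, Finset.card_union_of_disjoint d2, cC, hB']; omega
  have z1 : ZZ q k (fun i j => if j ≤ i + n ∧ i ≤ j + k then 1 else 0) T =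
      ZZ q k (fun i j => if j ≤ n + i then 1 else 0) T := by
    apply ZZ_congr
    intro i hi j _
    congr 1
    rw [eq_iff_iff]
    omega
  have z2 : ZZ q n (fun i j => if j ≤ i + k + n ∧ i + k ≤ j + k then 1 else 0)
        (Finset.range (n + k) \ T) =
      ZZ q n (fun i j => if i ≤ j then 1 else 0) (Finset.range (n + k) \ T) := by
    apply ZZ_congr
    intro i hi j hj
    have := Finset.mem_range.1 (Finset.mem_sdiff.1 hj).1
    congr 1
    rw [eq_iff_iff]
    omega
  have hcross : crossInv T (Finset.range (n + k) \ T) = (n - m) * (k - m) +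
      crossInv A (Finset.range n \ A) + crossInv (Finset.Ico n (n + k) \ B) B := by
    rw [hU, hT, crossInv_union_left d1, crossInv_union_right d2, crossInv_union_right d2]
    have e1 : crossInv A B = 0 := by
      refine Finset.sum_eq_zero fun a ha => Finset.sum_eq_zero fun b hb => if_neg ?_
      have := hAn a ha; have := hBn b hb; omega
    have e2 : crossInv (Finset.Ico n (n + k) \ B) (Finset.range n \ A) = (n - m) * (k - m) := by
      rw [← cC, ← cD, crossInv, Finset.sum_congr rfl (fun a ha => Finset.sum_congr rfl
        (fun b hb => if_pos (lt_of_lt_of_le (hUC b hb) (hTD a ha).1)))]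
      simp [mul_comm]
    rw [e1, e2]
    ring
  rw [z1, z2, ZZ_upper q k (fun i => n + i) (fun i j h => by dsimp only; omega),
    ZZ_lower q n (fun i => i) (fun i j h => h) _ hUcard, hcross, hU, fB, fT, pow_add, pow_add]
  have p1 : ∏ i ∈ Finset.range k, qInt q ((T.filter (fun t => t ≤ n + i)).card - i) =
      ∏ i ∈ Finset.range k,
        qInt q (m + ((Finset.Ico n (n + k) \ B).filter (fun t => t ≤ n + i)).card - i) := by
    refine Finset.prod_congr rfl fun i _ => ?_
    rw [hT, Finset.filter_union, Finset.card_union_of_disjoint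
      (Finset.disjoint_filter_filter d1), Finset.filter_true_of_mem, hA']
    intro x hx
    have := hAn x hx; omega
  have p2 : ∏ i ∈ Finset.range n,
        qInt q ((((Finset.range n \ A) ∪ B).filter (fun t => i ≤ t)).card - (n - 1 - i)) =
      ∏ i ∈ Finset.range n,
        qInt q (m + ((Finset.range n \ A).filter (fun t => i ≤ t)).card - (n - 1 - i)) := by
    refine Finset.prod_congr rfl fun i hi => ?_
    rw [Finset.mem_range] at hi
    have hB2 : B.filter (fun t => i ≤ t) = B := by
      rw [Finset.filter_true_of_mem]
      intro x hx
      have := hBn x hx; omega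
    rw [Finset.filter_union, Finset.card_union_of_disjoint
      (Finset.disjoint_filter_filter d2), hB2, hB', add_comm]
  rw [p1, p2]
  ring

/-- For every real `q ≠ 0`,
`pB_{n,k}(q) = ∑_{π ∈ V_n^k} q^{inv(π)}
  = q^{nk} ∑_{m=0}^{min(n,k)} S_{n+1,m+1}(1/q) S_{k+1,m+1}(1/q) ([m]!_q)² q^m`. -/
theorem pB_eq_qrook_formula (n k : ℕ) (q : ℝ) (hq : q ≠ 0) :
    (∑ π ∈ Finset.univ.filter (fun π : Equiv.Perm (Fin (n + k)) => IsVesztergombi n k π),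
        q ^ inversions π)
      = q ^ (n * k) * ∑ m ∈ Finset.range (min n k + 1),
          qStirS q⁻¹ (n + 1) (m + 1) * qStirS q⁻¹ (k + 1) (m + 1) * (qFact q m) ^ 2 * q ^ m := by
  rw [perm_sum_eq_ZZ, add_comm n k, laplace, add_comm k n, split_sum, Finset.mul_sum]
  refine Finset.sum_congr rfl fun m hm => ?_
  rw [Finset.mem_range] at hm
  have hmn : m ≤ n := by omega
  have hmk : m ≤ k := by omega
  have h1 : ∀ A ∈ (Finset.range n).powersetCard m, ∀ B ∈ (Finset.Ico n (n + k)).powersetCard m, _ :=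
    fun A hA B hB => summand_eq n k m q A B (Finset.mem_powersetCard.1 hA).1
      (Finset.mem_powersetCard.1 hA).2 (Finset.mem_powersetCard.1 hB).1
      (Finset.mem_powersetCard.1 hB).2 hmn hmk _ rfl
  rw [Finset.sum_congr rfl fun A hA => Finset.sum_congr rfl fun B hB => h1 A hA B hB]
  simp_rw [← Finset.mul_sum]
  rw [← Finset.sum_mul, sum_fT, sum_fB]
  have e1 := Fr_eq q hq n m
  have e2 := Fr_eq q hq k m
  have hm2 : m * m = m + 2 * m.choose 2 := by
    rw [Nat.choose_two_right, Nat.mul_div_cancel' (Nat.even_mul_pred_self m).two_dvd]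
    cases m with
    | zero => rfl
    | succ m => simp only [Nat.add_sub_cancel]; ring
  have e3 : q ^ ((n - m) * (k - m)) * (q ^ (m * n) * q ^ (m * k)) =
      q ^ (n * k) * q ^ m * (q ^ (m.choose 2)) ^ 2 := by
    rw [← pow_mul, ← pow_add, ← pow_add, ← pow_add, ← pow_add]
    congr 1
    obtain ⟨a, rfl⟩ := Nat.exists_eq_add_of_le hmn
    obtain ⟨b, rfl⟩ := Nat.exists_eq_add_of_le hmk
    simp only [Nat.add_sub_cancel_left]
    nlinarith [hm2]
  have hne : (q ^ (m.choose 2)) ^ 2 ≠ 0 := pow_ne_zero _ (pow_ne_zero _ hq)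
  apply mul_left_cancel₀ hne
  have e4 : (q ^ (m.choose 2)) ^ 2 * (q ^ ((n - m) * (k - m)) * (Fr q n m * Fr q k m)) =
      q ^ ((n - m) * (k - m)) *
        ((q ^ (m.choose 2) * Fr q n m) * (q ^ (m.choose 2) * Fr q k m)) := by ring
  rw [e4, e1, e2]
  linear_combination (qStirS q⁻¹ (n + 1) (m + 1) * qStirS q⁻¹ (k + 1) (m + 1) * qFact q m ^ 2) * e3
end
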